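/- Let d ≥ 2 be an integer and let φ : ℝ → [0,∞) be even, continuously differentiable and integrable, with φ'(u) < 0 for 0 < u < Υ and φ(u) = 0 for |u| ≥ Υ (Υ ∈ (0,∞]), and whose Fourier transform φ̂(t) = ∫_ℝ e^{iut} φ(u) du satisfies |φ̂(t)| + |φ̂'(t)| ≤ C(1+|t|)^{-N₀} for some N₀ ≥ 2. Define D(λ,k) := 1 + (|k|^{-2}/(2|k|)) [ H((−iλ + |k|²)/(2|k|)) − H((−iλ − |k|²)/(2|k|)) ] for k ≠ 0 and Re λ > 0, where H(z) := ∫_ℝ φ(u)/(z − u) du. Then for every k ∈ ℝ^d with k ≠ 0 and every δ₀ > 0 there is a constant c₀ > 0 such that |D(λ,k)| ≥ c₀ for all λ ∈ ℂ with Re λ ≥ δ₀; moreover c₀ can be chosen independently of k on the region |k| ≥ 1. -/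

import Mathlib

open MeasureTheory ENNReal

/-- The Cauchy integral `H(z) = ∫_ℝ φ(u)/(z − u) du`. -/
noncomputable def Hcauchy (φ : ℝ → ℝ) (z : ℂ) : ℂ :=
  ∫ u : ℝ, (φ u : ℂ) / (z - (u : ℂ))

/-- The Coulomb dielectric function. -/
noncomputable def Dcoulomb {d : ℕ} (φ : ℝ → ℝ) (lam : ℂ)
    (k : EuclideanSpace ℝ (Fin d)) : ℂ :=
  1 + (((‖k‖ : ℂ) ^ 2)⁻¹ / (2 * (‖k‖ : ℂ))) *
    (Hcauchy φ ((-Complex.I * lam + (‖k‖ : ℂ) ^ 2) / (2 * (‖k‖ : ℂ))) -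
     Hcauchy φ ((-Complex.I * lam - (‖k‖ : ℂ) ^ 2) / (2 * (‖k‖ : ℂ))))

/-- The Fourier transform `φ̂(t) = ∫_ℝ e^{iut} φ(u) du`. -/
noncomputable def fourierPhi (φ : ℝ → ℝ) (t : ℝ) : ℂ :=
  ∫ u : ℝ, Complex.exp (Complex.I * u * t) * (φ u : ℂ)


lemma aux_anti (φ : ℝ → ℝ) (Υ : ℝ≥0∞)
    (hpos : ∀ u : ℝ, 0 ≤ φ u)
    (hC1 : ContDiff ℝ 1 φ)
    (hmono : ∀ u : ℝ, 0 < u → ENNReal.ofReal u < Υ → deriv φ u < 0)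
    (hsupp : ∀ u : ℝ, Υ ≤ ENNReal.ofReal |u| → φ u = 0)
    (u v : ℝ) (hu : 0 ≤ u) (huv : u ≤ v) : φ v ≤ φ u := by
  have hv : 0 ≤ v := hu.trans huv
  by_cases h : Υ ≤ ENNReal.ofReal |v|
  · rw [hsupp v h]; exact hpos u
  · rw [abs_of_nonneg hv] at h
    push Not at h
    have hd : Differentiable ℝ φ := hC1.differentiable (by norm_num)
    have := antitoneOn_of_deriv_nonpos (convex_Icc (0:ℝ) v) hC1.continuous.continuousOn
      hd.differentiableOn (by
        intro x hx
        rw [interior_Icc] at hx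
        exact (hmono x hx.1 ((ENNReal.ofReal_le_ofReal hx.2.le).trans_lt h)).le)
    exact this ⟨hu, huv⟩ ⟨hv, le_rfl⟩ huv

lemma aux_g (φ : ℝ → ℝ) (heven : ∀ u : ℝ, φ (-u) = φ u)
    (hanti : ∀ u v : ℝ, 0 ≤ u → u ≤ v → φ v ≤ φ u) (a : ℝ) (ha : 0 < a) (u : ℝ) :
    0 ≤ u * (φ (u - a) - φ (u + a)) := by
  have habs : ∀ s, φ s = φ |s| := by
    intro s
    rcases abs_choice s with h | h <;> rw [h]
    exact (heven s).symm
  rw [habs (u - a), habs (u + a)]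
  rcases le_total 0 u with hu | hu
  · have : |u - a| ≤ |u + a| := by
      apply sq_le_sq.1
      nlinarith
    have := hanti _ _ (abs_nonneg _) this
    exact mul_nonneg hu (by linarith)
  · have : |u + a| ≤ |u - a| := by
      apply sq_le_sq.1
      nlinarith
    have := hanti _ _ (abs_nonneg _) this
    exact mul_nonneg_of_nonpos_of_nonpos hu (by linarith)

lemma aux_h (φ : ℝ → ℝ) (hpos : ∀ u : ℝ, 0 ≤ φ u) (hc : Continuous φ) (hint : Integrable φ)
    (a : ℝ) (ha : 0 < a)
    (hg : ∀ u, 0 ≤ u * (φ (u - a) - φ (u + a))) :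
    Integrable (fun u => u * (φ (u - a) - φ (u + a))) ∧
    ∫ u, u * (φ (u - a) - φ (u + a)) ≤ 2 * a * ∫ u, φ u := by
  have hcont : Continuous (fun u => u * (φ (u - a) - φ (u + a))) := by fun_prop
  have hψ : Continuous (fun u => u * φ u) := by fun_prop
  have hb : ∀ R : ℝ, a ≤ R → ∫ u in (-R)..R, u * (φ (u - a) - φ (u + a)) ≤ 2 * a * ∫ u, φ u := by
    intro R hR
    have e1 : ∀ u, u * (φ (u - a) - φ (u + a)) =
      ((u - a) * φ (u - a) - (u + a) * φ (u + a)) + a * (φ (u - a) + φ (u + a)) := by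
      intro u; ring
    simp_rw [e1]
    have c1 : Continuous (fun u => (u - a) * φ (u - a)) := by fun_prop
    have c2 : Continuous (fun u => (u + a) * φ (u + a)) := by fun_prop
    have c3 : Continuous (fun u => φ (u - a)) := by fun_prop
    have c12 : Continuous (fun u => (u - a) * φ (u - a) - (u + a) * φ (u + a)) := by fun_prop
    have c34 : Continuous (fun u => a * (φ (u - a) + φ (u + a))) := by fun_prop
    have c4 : Continuous (fun u => φ (u + a)) := by fun_prop
    rw [intervalIntegral.integral_add (c12.intervalIntegrable _ _)
      (c34.intervalIntegrable _ _),
      intervalIntegral.integral_sub (c1.intervalIntegrable _ _) (c2.intervalIntegrable _ _),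
      intervalIntegral.integral_const_mul,
      intervalIntegral.integral_add (c3.intervalIntegrable _ _) (c4.intervalIntegrable _ _),
      intervalIntegral.integral_comp_sub_right (fun u => u * φ u),
      intervalIntegral.integral_comp_add_right (fun u => u * φ u),
      intervalIntegral.integral_comp_sub_right (fun u => φ u),
      intervalIntegral.integral_comp_add_right (fun u => φ u)]
    have hle : ∀ p q : ℝ, p ≤ q → ∫ u in p..q, φ u ≤ ∫ u, φ u := by
      intro p q hpq
      rw [intervalIntegral.integral_of_le hpq]
      exact setIntegral_le_integral hint (Filter.Eventually.of_forall hpos)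
    have i1 := hle (-R - a) (R - a) (by linarith)
    have i2 := hle (-R + a) (R + a) (by linarith)
    have ii : ∀ p q, IntervalIntegrable (fun u => u * φ u) volume p q :=
      fun p q => hψ.intervalIntegrable p q
    have s1 := intervalIntegral.integral_add_adjacent_intervals (ii (-R - a) (-R + a))
      (ii (-R + a) (R - a))
    have s2 := intervalIntegral.integral_add_adjacent_intervals (ii (-R + a) (R - a))
      (ii (R - a) (R + a))
    have n1 : ∫ u in (-R - a)..(-R + a), u * φ u ≤ 0 := by
      rw [← neg_nonneg, ← intervalIntegral.integral_neg]
      apply intervalIntegral.integral_nonneg (by linarith)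
      intro u hu
      exact neg_nonneg.2 (mul_nonpos_of_nonpos_of_nonneg (by linarith [hu.2]) (hpos u))
    have n2 : 0 ≤ ∫ u in (R - a)..(R + a), u * φ u := by
      apply intervalIntegral.integral_nonneg (by linarith)
      intro u hu
      exact mul_nonneg (by linarith [hu.1]) (hpos u)
    nlinarith
  have hI : Integrable (fun u => u * (φ (u - a) - φ (u + a))) := by
    refine integrable_of_intervalIntegral_norm_bounded (l := Filter.atTop) (a := fun R : ℝ => -R)
      (b := fun R : ℝ => R) (2 * a * ∫ u, φ u) ?_ Filter.tendsto_neg_atTop_atBot Filter.tendsto_id ?_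
    · intro R
      exact (hcont.integrableOn_Icc).mono_set Set.Ioc_subset_Icc_self
    · filter_upwards [Filter.eventually_ge_atTop a] with R hR
      have : ∀ u, ‖u * (φ (u - a) - φ (u + a))‖ = u * (φ (u - a) - φ (u + a)) :=
        fun u => by rw [Real.norm_eq_abs, abs_of_nonneg (hg u)]
      simp_rw [this]
      exact hb R hR
  refine ⟨hI, ?_⟩
  have ht := intervalIntegral_tendsto_integral hI (l := Filter.atTop) (a := fun R : ℝ => -R)
      (b := fun R : ℝ => R) Filter.tendsto_neg_atTop_atBot Filter.tendsto_id
  refine le_of_tendsto ht ?_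
  filter_upwards [Filter.eventually_ge_atTop a] with R hR
  exact hb R hR

lemma aux_int (f : ℝ → ℝ) (hf : Integrable f) (z : ℂ) (hz : z.im ≠ 0) :
    Integrable (fun u : ℝ => (f u : ℂ) / (z - (u : ℂ))) := by
  have hne : ∀ u : ℝ, z - (u : ℂ) ≠ 0 := by
    intro u h
    apply hz
    have := congrArg Complex.im h
    simpa using this
  simp_rw [div_eq_mul_inv]
  refine hf.ofReal.mul_bdd (c := |z.im|⁻¹) ?_ (Filter.Eventually.of_forall ?_)
  · apply Continuous.aestronglyMeasurable
    exact Continuous.inv₀ (by fun_prop) hne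
  · intro u
    rw [norm_inv]
    apply inv_anti₀ (abs_pos.2 hz)
    have := Complex.abs_im_le_norm (z - (u : ℂ))
    simpa using this

lemma aux_H (φ : ℝ → ℝ) (heven : ∀ u : ℝ, φ (-u) = φ u) (hint : Integrable φ) (a : ℝ)
    (z : ℂ) (hz : z.im ≠ 0) :
    Hcauchy φ (z + a) - Hcauchy φ (z - a) =
      ∫ u : ℝ, ((u * (φ (u - a) - φ (u + a)) : ℝ) : ℂ) / ((u : ℂ) ^ 2 - z ^ 2) := by
  have ip : Integrable (fun u => φ (u + a)) := hint.comp_add_right a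
  have im : Integrable (fun u => φ (u - a)) := hint.comp_sub_right a
  have e1 : Hcauchy φ (z + a) = ∫ u : ℝ, (φ (u + a) : ℂ) / (z - u) := by
    unfold Hcauchy
    rw [← integral_add_right_eq_self _ a]
    congr 1; ext u; push_cast; congr 1; ring
  have e2 : Hcauchy φ (z - a) = ∫ u : ℝ, (φ (u - a) : ℂ) / (z - u) := by
    unfold Hcauchy
    rw [← integral_sub_right_eq_self _ a]
    congr 1; ext u; push_cast; congr 1; ring
  have j1 := aux_int _ ip z hz
  have j2 := aux_int _ im z hz
  have hK := j1.sub j2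
  rw [e1, e2, ← integral_sub j1 j2]
  set K : ℝ → ℂ := fun u => (φ (u + a) : ℂ) / (z - u) - (φ (u - a) : ℂ) / (z - u) with hKd
  have hKi : Integrable K := hK
  have hn : ∫ u, K u = ∫ u, K (-u) := (integral_neg_eq_self K volume).symm
  have h2 : ∫ u, K u = ∫ u, (1/2 : ℂ) * (K u + K (-u)) := by
    rw [integral_const_mul, integral_add hKi hKi.comp_neg, ← hn]; ring
  rw [h2]
  congr 1; ext u
  have a1 : z - u ≠ 0 := by
    intro h
    apply hz
    simpa using congrArg Complex.im h
  have a2 : z + u ≠ 0 := by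
    intro h
    apply hz
    simpa using congrArg Complex.im h
  have a3 : (u:ℂ) ^ 2 - z ^ 2 ≠ 0 := by
    have : (u:ℂ) ^ 2 - z ^ 2 = -((z - u) * (z + u)) := by ring
    rw [this]; exact neg_ne_zero.2 (mul_ne_zero a1 a2)
  have b1 : φ (-u + a) = φ (u - a) := by rw [← heven]; congr 1; ring
  have b2 : φ (-u - a) = φ (u + a) := by rw [← heven]; congr 1; ring
  simp only [hKd, b1, b2]
  push_cast
  rw [sub_neg_eq_add]
  field_simp
  ring

/-- abstract lower bound -/
lemma aux_F (h : ℝ → ℝ) (hh : ∀ u, 0 ≤ h u) (hi : Integrable h) (M : ℝ) (hM : ∫ u, h u ≤ M)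
    (x y : ℝ) (y0 : ℝ) (hy0 : 0 < y0) (hy : y0 ≤ y) (z : ℂ) (hz : z = ⟨x, -y⟩)
    (c : ℝ) (hc1 : c ≤ 1 / 2) (hc2 : c * M ≤ y0 ^ 2) :
    c ≤ ‖1 + ∫ u : ℝ, (h u : ℂ) / ((u : ℂ) ^ 2 - z ^ 2)‖ := by
  have hypos : 0 < y := hy0.trans_le hy
  have hM0 : 0 ≤ M := (integral_nonneg hh).trans hM
  set w := z ^ 2 with hw
  have wre : w.re = x ^ 2 - y ^ 2 := by rw [hw, hz]; simp [pow_two]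
  have wim : w.im = - (2 * x * y) := by rw [hw, hz]; simp [pow_two]; ring
  have hzim : z.im = -y := by rw [hz]
  have hzre : z.re = x := by rw [hz]
  have hne : ∀ u : ℝ, (u : ℂ) ^ 2 - w ≠ 0 := by
    intro u hu
    have e : (u : ℂ) ^ 2 - w = (u - z) * (u + z) := by rw [hw]; ring
    rw [e] at hu
    rcases mul_eq_zero.1 hu with h | h
    · have := congrArg Complex.im h
      simp [hzim] at this; linarith
    · have := congrArg Complex.im h
      simp [hzim] at this; linarith
  have hwnorm : ∀ u : ℝ, y ^ 2 ≤ ‖(u : ℂ) ^ 2 - w‖ := by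
    intro u
    have e : (u : ℂ) ^ 2 - w = (u - z) * (u + z) := by rw [hw]; ring
    rw [e, norm_mul, pow_two]
    have h1 := Complex.abs_im_le_norm ((u:ℂ) - z)
    have h2 := Complex.abs_im_le_norm ((u:ℂ) + z)
    simp [hzim, abs_of_pos hypos] at h1 h2
    gcongr
  have hI : Integrable (fun u : ℝ => (h u : ℂ) / ((u : ℂ) ^ 2 - w)) := by
    simp_rw [div_eq_mul_inv]
    refine hi.ofReal.mul_bdd (c := (y ^ 2)⁻¹) ?_ (Filter.Eventually.of_forall ?_)
    · apply Continuous.aestronglyMeasurable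
      exact Continuous.inv₀ (by fun_prop) hne
    · intro u
      rw [norm_inv]
      exact inv_anti₀ (by positivity) (hwnorm u)
  set J := ∫ u : ℝ, (h u : ℂ) / ((u : ℂ) ^ 2 - w) with hJ
  have hns : ∀ u : ℝ, 0 < Complex.normSq ((u : ℂ) ^ 2 - w) := fun u => Complex.normSq_pos.2 (hne u)
  have hu2re : ∀ u : ℝ, ((u : ℂ) ^ 2).re = u ^ 2 := fun u => by norm_cast
  have hu2im : ∀ u : ℝ, ((u : ℂ) ^ 2).im = 0 := fun u => by norm_cast
  rcases le_or_gt |x| y with hxy | hxy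
  · -- real part at least one
    have hx2 : x ^ 2 ≤ y ^ 2 := sq_le_sq' (by linarith [neg_abs_le x]) ((le_abs_self x).trans hxy)
    have hre : 0 ≤ J.re := by
      have : J.re = ∫ u : ℝ, ((h u : ℂ) / ((u : ℂ) ^ 2 - w)).re := (integral_re hI).symm
      rw [this]
      apply integral_nonneg
      intro u
      simp only [Pi.zero_apply, Complex.div_re, Complex.ofReal_re, Complex.ofReal_im, Complex.sub_re,
        hu2re, zero_mul, zero_div, add_zero]
      apply div_nonneg _ (hns u).le
      apply mul_nonneg (hh u)
      rw [wre]; nlinarith [sq_nonneg u]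
    have := (Complex.re_le_norm (1 + J))
    simp at this
    linarith
  · have hx0 : 0 < |x| := hypos.trans hxy
    have him : |w.im| = 2 * |x| * y := by
      rw [wim, abs_neg, abs_mul, abs_mul, abs_of_pos hypos]; norm_num
    have himpos : 0 < |w.im| := by rw [him]; positivity
    rcases le_or_gt M (|x| * y) with hb | hb
    · have hJn : ‖J‖ ≤ |w.im|⁻¹ * M := by
        calc ‖J‖ ≤ ∫ u : ℝ, |w.im|⁻¹ * h u := by
              apply norm_integral_le_of_norm_le (hi.const_mul _)
              refine Filter.Eventually.of_forall fun u => ?_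
              rw [norm_div, Complex.norm_real, Real.norm_eq_abs, abs_of_nonneg (hh u),
                div_eq_inv_mul]
              apply mul_le_mul_of_nonneg_right _ (hh u)
              apply inv_anti₀ himpos
              have := Complex.abs_im_le_norm ((u : ℂ) ^ 2 - w)
              rwa [Complex.sub_im, hu2im, zero_sub, abs_neg] at this
          _ = |w.im|⁻¹ * ∫ u, h u := integral_const_mul _ _
          _ ≤ _ := by gcongr
      have : |w.im|⁻¹ * M ≤ 1 / 2 := by
        rw [inv_mul_le_iff₀ himpos, him]; linarith
      have h3 := norm_sub_le (1 + J) J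
      simp at h3
      linarith
    · -- use Im (w F)
      have key : w.im ^ 2 ≤ w.im * (w * (1 + J)).im := by
        have e : w.im * (w * J).im = ∫ u : ℝ, (w.im * ((w * ((h u : ℂ) / ((u : ℂ) ^ 2 - w))).im)) := by
          rw [integral_const_mul]
          congr 1
          have : (∫ u : ℝ, w * ((h u : ℂ) / ((u : ℂ) ^ 2 - w))).im =
              ∫ u : ℝ, (w * ((h u : ℂ) / ((u : ℂ) ^ 2 - w))).im :=
            (integral_im (hI.const_mul w)).symm
          rw [← this, integral_const_mul]
        have nn : 0 ≤ w.im * (w * J).im := by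
          rw [e]
          apply integral_nonneg
          intro u
          have e2 : (w * ((h u : ℂ) / ((u : ℂ) ^ 2 - w))).im
              = h u * u ^ 2 * w.im / Complex.normSq ((u : ℂ) ^ 2 - w) := by
            rw [Complex.mul_im, Complex.div_re, Complex.div_im]
            simp only [Complex.ofReal_re, Complex.ofReal_im, Complex.sub_re, Complex.sub_im,
              hu2re, hu2im]
            ring
          simp only [Pi.zero_apply]
          rw [e2]
          have : w.im * (h u * u ^ 2 * w.im / Complex.normSq ((u : ℂ) ^ 2 - w)) =
            h u * (u * w.im) ^ 2 / Complex.normSq ((u : ℂ) ^ 2 - w) := by ring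
          rw [this]
          exact div_nonneg (mul_nonneg (hh u) (sq_nonneg _)) (hns u).le
        have : (w * (1 + J)).im = w.im + (w * J).im := by rw [mul_add, mul_one, Complex.add_im]
        rw [this]; nlinarith
      have k2 : |w.im| ≤ ‖w‖ * ‖1 + J‖ := by
        have t1 : w.im * (w * (1 + J)).im ≤ |w.im| * (‖w‖ * ‖1 + J‖) := by
          rw [← norm_mul]
          refine (le_abs_self _).trans ?_
          rw [abs_mul]
          gcongr
          exact Complex.abs_im_le_norm _
        rw [← sq_abs, pow_two] at key
        exact le_of_mul_le_mul_left (key.trans t1) himpos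
      have hwn : ‖w‖ = x ^ 2 + y ^ 2 := by
        rw [hw, norm_pow, ← Complex.normSq_eq_norm_sq, Complex.normSq_apply, hzre, hzim]; ring
      rw [him, hwn] at k2
      set N := ‖1 + J‖ with hN
      have hN0 : 0 ≤ N := norm_nonneg _
      rw [← sq_abs x] at k2
      set X := |x| with hX
      -- y ≤ X * N
      have k3 : y ≤ X * N := by
        have : X ^ 2 + y ^ 2 ≤ 2 * X ^ 2 := by nlinarith
        have : 2 * X * y ≤ 2 * X ^ 2 * N := k2.trans (by gcongr)
        have : (2 * X) * y ≤ (2 * X) * (X * N) := by linarith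
        exact le_of_mul_le_mul_left this (by positivity)
      have k4 : y ^ 2 ≤ M * N := by
        calc y ^ 2 = y * y := pow_two y
          _ ≤ y * (X * N) := by gcongr
          _ = (X * y) * N := by ring
          _ ≤ M * N := by gcongr
      have k5 : c * M ≤ N * M := by nlinarith
      exact le_of_mul_le_mul_right k5 (lt_trans (by positivity) hb)

theorem stmt5 (d : ℕ) (hd : 2 ≤ d) (φ : ℝ → ℝ) (Υ : ℝ≥0∞) (hΥ : 0 < Υ)
    (hpos : ∀ u : ℝ, 0 ≤ φ u)
    (heven : ∀ u : ℝ, φ (-u) = φ u)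
    (hC1 : ContDiff ℝ 1 φ)
    (hint : Integrable φ)
    (hmono : ∀ u : ℝ, 0 < u → ENNReal.ofReal u < Υ → deriv φ u < 0)
    (hsupp : ∀ u : ℝ, Υ ≤ ENNReal.ofReal |u| → φ u = 0)
    (C N₀ : ℝ) (hN₀ : 2 ≤ N₀)
    (hFdecay : ∀ t : ℝ,
      ‖fourierPhi φ t‖ + ‖deriv (fourierPhi φ) t‖ ≤ C * (1 + |t|) ^ (-N₀)) :
    (∀ k : EuclideanSpace ℝ (Fin d), k ≠ 0 → ∀ δ₀ : ℝ, 0 < δ₀ →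
      ∃ c₀ : ℝ, 0 < c₀ ∧ ∀ lam : ℂ, δ₀ ≤ lam.re → c₀ ≤ ‖Dcoulomb φ lam k‖) ∧
    (∀ δ₀ : ℝ, 0 < δ₀ → ∃ c₀ : ℝ, 0 < c₀ ∧
      ∀ k : EuclideanSpace ℝ (Fin d), 1 ≤ ‖k‖ →
        ∀ lam : ℂ, δ₀ ≤ lam.re → c₀ ≤ ‖Dcoulomb φ lam k‖) := by
  have hanti := aux_anti φ Υ hpos hC1 hmono hsupp
  set I := ∫ u, φ u with hI
  have hI0 : 0 ≤ I := integral_nonneg hpos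
  have main : ∀ δ₀ : ℝ, 0 < δ₀ → ∃ c₀ : ℝ, 0 < c₀ ∧
      ∀ k : EuclideanSpace ℝ (Fin d), k ≠ 0 →
        ∀ lam : ℂ, δ₀ ≤ lam.re → c₀ ≤ ‖Dcoulomb φ lam k‖ := by
    intro δ₀ hδ
    refine ⟨min (1 / 2) (δ₀ ^ 2 / (2 * (I + 1))), by positivity, ?_⟩
    intro k hk lam hlam
    set c := min (1 / 2) (δ₀ ^ 2 / (2 * (I + 1))) with hc
    have hr : 0 < ‖k‖ := norm_pos_iff.2 hk
    unfold Dcoulomb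
    set r := ‖k‖ with hrdef
    have hrC : (r : ℂ) ≠ 0 := by exact_mod_cast hr.ne'
    have ha : 0 < r / 2 := by positivity
    obtain ⟨hi1, hi2⟩ := aux_h φ hpos hC1.continuous hint (r / 2) ha (aux_g φ heven hanti (r / 2) ha)
    have hg := aux_g φ heven hanti (r / 2) ha
    set z : ℂ := ⟨lam.im / (2 * r), -(lam.re / (2 * r))⟩ with hz
    have hlr : 0 < lam.re := hδ.trans_le hlam
    have hz0 : z.im ≠ 0 := by
      rw [hz]; exact neg_ne_zero.2 (by positivity)
    have hzl : z = -Complex.I * lam / (2 * r) := by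
      have : (2 * (r:ℂ)) = ((2 * r : ℝ) : ℂ) := by push_cast; rfl
      rw [this]
      apply Complex.ext
      · rw [Complex.div_ofReal_re]; simp [hz]
      · rw [Complex.div_ofReal_im]; simp [hz]; ring
    have z1 : (-Complex.I * lam + (r : ℂ) ^ 2) / (2 * (r : ℂ)) = z + ((r / 2 : ℝ) : ℂ) := by
      rw [hzl]; push_cast; field_simp
    have z2 : (-Complex.I * lam - (r : ℂ) ^ 2) / (2 * (r : ℂ)) = z - ((r / 2 : ℝ) : ℂ) := by
      rw [hzl]; push_cast; field_simp
    rw [z1, z2, aux_H φ heven hint (r / 2) z hz0, ← integral_const_mul]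
    have e : (fun u : ℝ => ((r : ℂ) ^ 2)⁻¹ / (2 * (r : ℂ)) *
        (((u * (φ (u - r / 2) - φ (u + r / 2)) : ℝ) : ℂ) / ((u : ℂ) ^ 2 - z ^ 2))) =
        fun u : ℝ => (((1 / (2 * r ^ 3)) * (u * (φ (u - r / 2) - φ (u + r / 2))) : ℝ) : ℂ) /
          ((u : ℂ) ^ 2 - z ^ 2) := by
      ext u
      rw [← mul_div_assoc]
      congr 1
      push_cast
      congr 1
      field_simp
    rw [e]
    refine aux_F (fun u => (1 / (2 * r ^ 3)) * (u * (φ (u - r / 2) - φ (u + r / 2))))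
      (fun u => mul_nonneg (by positivity) (hg u)) (hi1.const_mul _) (I / (2 * r ^ 2)) ?_
      (lam.im / (2 * r)) (lam.re / (2 * r)) (δ₀ / (2 * r)) (by positivity) (by gcongr) z hz c
      (min_le_left _ _) ?_
    · rw [integral_const_mul]
      calc _ ≤ 1 / (2 * r ^ 3) * (2 * (r / 2) * I) := by gcongr
        _ = _ := by field_simp
    · calc c * (I / (2 * r ^ 2)) ≤ δ₀ ^ 2 / (2 * (I + 1)) * ((I + 1) / (2 * r ^ 2)) := by
            gcongr
            · exact min_le_right _ _
            · linarith
        _ = _ := by field_simp <;> norm_num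
  constructor
  · intro k hk δ₀ hδ
    obtain ⟨c, hc, h⟩ := main δ₀ hδ
    exact ⟨c, hc, h k hk⟩
  · intro δ₀ hδ
    obtain ⟨c, hc, h⟩ := main δ₀ hδ
    refine ⟨c, hc, fun k hk => h k ?_⟩
    rintro rfl
    simp at hk
    try linarith
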